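/- Let Φ : 𝒜 → ℬ be a unital positive (not necessarily linear) map between unital C*-algebras with Φ(0) = 0 that enjoys property 𝒟_m for some m ≥ 4. Then for all self-adjoint A, B ∈ 𝒜 the matrix [[Var_Φ(A), Φ((1/2){A,B}) − Φ(A)Φ(B)], [Φ((1/2){A,B}) − Φ(B)Φ(A), Var_Φ(B)]] is positive in M₂(ℬ), where {A,B} = AB + BA. -/

import Mathlib

/-- An element of a C*-algebra is positive if and only if it is of the form `star b * b`. -/
def IsPosElem {A : Type*} [Mul A] [Star A] (a : A) : Prop := ∃ b : A, a = star b * b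

/-- A (not necessarily linear) map `Φ : A → B` is `n`-positive if the entrywise induced map
on `n × n` matrices sends positive matrices to positive matrices. -/
def IsNPosMap {A B : Type*} [NonUnitalNonAssocSemiring A] [Star A]
    [NonUnitalNonAssocSemiring B] [Star B] (n : ℕ) (Φ : A → B) : Prop :=
  ∀ M : Matrix (Fin n) (Fin n) A, IsPosElem M → IsPosElem (M.map Φ)

universe v

/-- A unital positive map `Φ` enjoys property `𝒟_m` if it factors as `Φ = φ ∘ ψ` where
`ψ` is a unital positive linear map into some `C(Ω)` (`Ω` compact Hausdorff) and
`φ : C(Ω) → ℬ` is a unital `m`-positive map. -/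
def PropertyD {𝒜 ℬ : Type*} [CStarAlgebra 𝒜] [CStarAlgebra ℬ] (m : ℕ) (Φ : 𝒜 → ℬ) : Prop :=
  ∃ (Ω : Type v) (_ : TopologicalSpace Ω) (_ : CompactSpace Ω) (_ : T2Space Ω)
    (ψ : 𝒜 →ₗ[ℂ] C(Ω, ℂ)) (φ : C(Ω, ℂ) → ℬ),
    ψ 1 = 1 ∧ (∀ a : 𝒜, IsPosElem a → IsPosElem (ψ a)) ∧
    φ 1 = 1 ∧ IsNPosMap m φ ∧ ∀ a : 𝒜, Φ a = φ (ψ a)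

section AnticommHelpers

open scoped ComplexOrder Matrix.Norms.L2Operator MatrixOrder NNReal

/-- A matrix over `C(Ω, ℂ)` that is pointwise positive semidefinite is positive. -/
theorem aux_pos_of_pointwise {Ω : Type*} [TopologicalSpace Ω] {n : ℕ}
    (M : Matrix (Fin n) (Fin n) C(Ω, ℂ))
    (h : ∀ w : Ω, (M.map (fun f => f w)).PosSemidef) : IsPosElem M := by
  let N : Ω → Matrix (Fin n) (Fin n) ℂ := fun w => M.map (fun f => f w)
  have hN : Continuous N := by
    refine continuous_matrix fun i j => ?_
    exact (M i j).continuous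
  have hN0 : ∀ w, 0 ≤ N w := fun w => Matrix.nonneg_iff_posSemidef.mpr (h w)
  have hS : Continuous fun w => cfc NNReal.sqrt (N w) := by
    refine Continuous.cfc_nnreal_of_mem_nhdsSet (s := Set.univ) NNReal.sqrt
      Filter.univ_mem hN hN0 ?_
    exact NNReal.continuous_sqrt.continuousOn
  refine ⟨Matrix.of fun i j => ⟨fun w => cfc NNReal.sqrt (N w) i j, hS.matrix_elem i j⟩, ?_⟩
  ext i j w
  have h1 : star (cfc NNReal.sqrt (N w)) * cfc NNReal.sqrt (N w) = N w := by
    have hs : 0 ≤ cfc NNReal.sqrt (N w) := cfc_predicate _ _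
    rw [(IsSelfAdjoint.of_nonneg hs).star_eq, ← cfc_mul (hf := by fun_prop) (hg := by fun_prop)]
    simp only [NNReal.mul_self_sqrt]
    exact cfc_id' ℝ≥0 (N w) (hN0 w)
  have h2 := congrFun (congrFun h1 i) j
  rw [Matrix.mul_apply] at h2
  simp only [Matrix.mul_apply, Matrix.star_apply, Matrix.of_apply, ContinuousMap.coe_sum,
    Finset.sum_apply, ContinuousMap.coe_mul, Pi.mul_apply]
  exact h2.symm

/-- Symmetrised Gram matrices are mapped to positive semidefinite matrices by positive
functionals. -/
theorem aux_gram {A : Type*} [CStarAlgebra A] {n : ℕ} (s : A →ₗ[ℂ] ℂ)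
    (hs : ∀ z : A, 0 ≤ s (star z * z)) (a : Fin n → A) (ha : ∀ i, star (a i) = a i) :
    (Matrix.of fun i j => s ((1 / 2 : ℂ) • (a i * a j + a j * a i))).PosSemidef := by
  have hreal : ∀ x : A, star x = x → star (s x) = s x := by
    intro x hx
    have h1 := hs (x + 1)
    have h2 := hs (x - 1)
    have e : s x = (1 / 4 : ℂ) * (s (star (x + 1) * (x + 1)) - s (star (x - 1) * (x - 1))) := by
      rw [← map_sub, ← smul_eq_mul, ← map_smul]
      congr 1
      simp only [star_add, star_sub, star_one, hx]
      have : (x + 1) * (x + 1) - (x - 1) * (x - 1) = (4 : ℂ) • x := by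
        rw [show (4 : ℂ) = 1 + 1 + 1 + 1 by norm_num]
        simp only [add_smul, one_smul]
        noncomm_ring
      rw [this, smul_smul]; norm_num
    have g1 := (IsSelfAdjoint.of_nonneg h1).star_eq
    have g2 := (IsSelfAdjoint.of_nonneg h2).star_eq
    rw [e, star_mul', star_sub, g1, g2]
    simp
  refine Matrix.PosSemidef.of_dotProduct_mulVec_nonneg ?_ ?_
  · ext i j
    simp only [Matrix.conjTranspose_apply, Matrix.of_apply]
    rw [hreal, add_comm]
    simp [ha, add_comm]
  · intro x
    have h1 := hs (∑ i, x i • a i)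
    have h2 := hs (∑ i, star (x i) • a i)
    have e : star x ⬝ᵥ ((Matrix.of fun i j => s ((1 / 2 : ℂ) • (a i * a j + a j * a i))).mulVec x)
        = (1 / 2 : ℂ) * (s (star (∑ i, x i • a i) * (∑ i, x i • a i))
          + s (star (∑ i, star (x i) • a i) * (∑ i, star (x i) • a i))) := by
      have e2 : s (star (∑ i, star (x i) • a i) * (∑ i, star (x i) • a i))
          = ∑ i, ∑ j, star (x i) * x j * s (a j * a i) := by
        simp only [star_sum, star_smul, ha, Finset.sum_mul, Finset.mul_sum, map_sum, star_star,
          smul_mul_assoc, mul_smul_comm, map_smul, smul_eq_mul, mul_assoc]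
      have e1 : s (star (∑ i, x i • a i) * (∑ i, x i • a i))
          = ∑ i, ∑ j, star (x i) * x j * s (a i * a j) := by
        simp only [star_sum, star_smul, ha, Finset.sum_mul, Finset.mul_sum, map_sum,
          smul_mul_assoc, mul_smul_comm, map_smul, smul_eq_mul, mul_assoc]
        rw [Finset.sum_comm]
        refine Finset.sum_congr rfl fun i _ => Finset.sum_congr rfl fun j _ => ?_
        ring
      rw [e1, e2, ← Finset.sum_add_distrib, Finset.mul_sum]
      simp only [dotProduct, Matrix.mulVec, Matrix.of_apply, Pi.star_apply]
      refine Finset.sum_congr rfl fun i _ => ?_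
      rw [← Finset.sum_add_distrib, Finset.mul_sum, Finset.mul_sum]
      refine Finset.sum_congr rfl fun j _ => ?_
      simp only [map_smul, map_add, smul_eq_mul]
      ring
    rw [e]
    refine mul_nonneg ?_ (add_nonneg h1 h2)
    rw [show (1 / 2 : ℂ) = ((1 / 2 : ℝ) : ℂ) by norm_num]
    exact Complex.zero_le_real.mpr (by norm_num)

end AnticommHelpers

/-- A sum of positive elements of a C*-algebra is positive. -/
theorem aux_sum {C : Type*} [CStarAlgebra C] {n : ℕ} (c : Fin n → C) :
    ∃ b : C, ∑ k, star (c k) * c k = star b * b := by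
  let _ : PartialOrder C := CStarAlgebra.spectralOrder C
  have _ : StarOrderedRing C := CStarAlgebra.spectralOrderedRing C
  exact CStarAlgebra.nonneg_iff_eq_star_mul_self.mp
    (Finset.sum_nonneg fun k _ => star_mul_self_nonneg _)

/-- A rectangular Gram matrix is positive. -/
theorem aux_rect {B : Type*} [CStarAlgebra B] {n : ℕ} (Y : Matrix (Fin n) (Fin 2) B) :
    IsPosElem (Y.conjTranspose * Y) := by
  let _ : PartialOrder B := CStarAlgebra.spectralOrder B
  have _ : StarOrderedRing B := CStarAlgebra.spectralOrderedRing B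
  let c : Fin n → CStarMatrix (Fin 2) (Fin 2) B := fun k =>
    CStarMatrix.ofMatrix (Matrix.of fun i j => if i = 0 then Y k j else 0)
  obtain ⟨b, hb⟩ := aux_sum c
  refine ⟨CStarMatrix.ofMatrix.symm b, ?_⟩
  have e : CStarMatrix.ofMatrix (Y.conjTranspose * Y) = ∑ k, star (c k) * c k := by
    ext i j
    have : ∀ (f : Fin n → CStarMatrix (Fin 2) (Fin 2) B), (∑ k, f k) i j = ∑ k, f k i j :=
      fun f => Matrix.sum_apply i j Finset.univ f
    rw [this]
    simp only [CStarMatrix.ofMatrix_apply, Matrix.mul_apply, Matrix.conjTranspose_apply]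
    refine Finset.sum_congr rfl fun k _ => ?_
    simp [c, CStarMatrix.mul_apply, CStarMatrix.star_apply]
  exact e.trans hb

/-- Theorem 4.1 (iv): if `Φ : 𝒜 → ℬ` is unital positive with `Φ(0) = 0` and enjoys
property `𝒟_m` for some `m ≥ 4`, then for self-adjoint `A, B` the anticommutator
covariance matrix
`[[Var_Φ(A), Φ((1/2){A,B}) − Φ(A)Φ(B)], [Φ((1/2){A,B}) − Φ(B)Φ(A), Var_Φ(B)]]`
is positive in `M₂(ℬ)`, where `{A,B} = AB + BA`. -/
theorem anticommutator_covariance_matrix_positive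
    {𝒜 ℬ : Type*} [CStarAlgebra 𝒜] [CStarAlgebra ℬ]
    (Φ : 𝒜 → ℬ) (hunital : Φ 1 = 1)
    (hpos : ∀ a : 𝒜, IsPosElem a → IsPosElem (Φ a)) (h0 : Φ 0 = 0)
    (m : ℕ) (hm : 4 ≤ m) (hD : PropertyD.{v} m Φ)
    (A B : 𝒜) (hA : star A = A) (hB : star B = B) :
    IsPosElem !![Φ (A * A) - Φ A * Φ A, Φ ((1 / 2 : ℂ) • (A * B + B * A)) - Φ A * Φ B;
                 Φ ((1 / 2 : ℂ) • (A * B + B * A)) - Φ B * Φ A,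
                 Φ (B * B) - Φ B * Φ B] := by
  obtain ⟨Ω, _, _, _, ψ, φ, hψ1, hψ, hφ1, hφ, hf⟩ := hD
  obtain ⟨k, rfl⟩ : ∃ k, m = k + 3 := ⟨m - 3, by omega⟩
  let a : Fin (k + 3) → 𝒜 := fun i => if i = 0 then A else if i = 1 then B else 1
  have ha : ∀ i, star (a i) = a i := by
    intro i
    simp only [a]
    split_ifs <;> simp [hA, hB]
  have hM := hφ (Matrix.of fun i j => ψ ((1 / 2 : ℂ) • (a i * a j + a j * a i)))
    (aux_pos_of_pointwise _ fun w => by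
      let s : 𝒜 →ₗ[ℂ] ℂ :=
        { toFun := fun x => ψ x w
          map_add' := by intro x y; simp
          map_smul' := by intro r x; simp }
      refine aux_gram s (fun z => ?_) a ha
      obtain ⟨b, hb⟩ := hψ _ ⟨z, rfl⟩
      open scoped ComplexOrder in
      change 0 ≤ ψ (star z * z) w
      rw [hb]
      exact star_mul_self_nonneg (b w))
  obtain ⟨Q, hQ⟩ := hM
  let P : Fin (k + 3) → Fin (k + 3) → ℬ := fun i j => Φ ((1 / 2 : ℂ) • (a i * a j + a j * a i))
  have hP : ∀ i j, P i j = ∑ l, star (Q l i) * Q l j := by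
    intro i j
    have := congrFun (congrFun hQ i) j
    rw [Matrix.mul_apply] at this
    simp only [P, hf]
    exact this
  have hstar : ∀ i j, star (P i j) = P i j := by
    intro i j
    have : P i j = P j i := by simp only [P, add_comm]
    have h1 : star (P i j) = P j i := by
      rw [hP i j, hP j i, star_sum]
      refine Finset.sum_congr rfl fun l _ => ?_
      rw [star_mul, star_star]
    rw [h1, this]
  have h2 : ∀ x : 𝒜, (1 / 2 : ℂ) • (x + x) = x := by
    intro x
    rw [← two_smul ℂ x, smul_smul]; norm_num
  have n10 : (1 : Fin (k + 3)) ≠ 0 := by simp [Fin.ext_iff]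
  have n20 : (2 : Fin (k + 3)) ≠ 0 := by
    simp [Fin.ext_iff, Fin.val_ofNat, Nat.mod_eq_of_lt (show 2 < k + 3 by omega)]
  have n21 : (2 : Fin (k + 3)) ≠ 1 := by
    simp [Fin.ext_iff, Fin.val_ofNat, Nat.mod_eq_of_lt (show 2 < k + 3 by omega)]
  have a0 : a 0 = A := by simp [a]
  have a1 : a 1 = B := by simp [a]
  have a2 : a 2 = 1 := by simp [a, n20, n21]
  have p22 : P 2 2 = 1 := by simp only [P, a2, mul_one, h2, hunital]
  have p02 : P 0 2 = Φ A := by simp only [P, a0, a2, mul_one, one_mul, h2]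
  have p12 : P 1 2 = Φ B := by simp only [P, a1, a2, mul_one, one_mul, h2]
  have p20 : P 2 0 = Φ A := by simp only [P, a0, a2, mul_one, one_mul, h2]
  have p21 : P 2 1 = Φ B := by simp only [P, a1, a2, mul_one, one_mul, h2]
  have p00 : P 0 0 = Φ (A * A) := by simp only [P, a0, h2]
  have p11 : P 1 1 = Φ (B * B) := by simp only [P, a1, h2]
  have p01 : P 0 1 = Φ ((1 / 2 : ℂ) • (A * B + B * A)) := by simp only [P, a0, a1]
  have p10 : P 1 0 = Φ ((1 / 2 : ℂ) • (A * B + B * A)) := by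
    simp only [P, a0, a1, add_comm]
  have key : ∀ i j, ∑ l, star (Q l i - Q l 2 * P i 2) * (Q l j - Q l 2 * P 2 j)
      = P i j - P i 2 * P 2 j := by
    intro i j
    have : ∀ l, star (Q l i - Q l 2 * P i 2) * (Q l j - Q l 2 * P 2 j)
        = star (Q l i) * Q l j - star (Q l i) * Q l 2 * P 2 j
          - P i 2 * (star (Q l 2) * Q l j) + P i 2 * (star (Q l 2) * Q l 2) * P 2 j := by
      intro l
      rw [star_sub, star_mul, hstar]
      noncomm_ring
    simp only [this, Finset.sum_add_distrib, Finset.sum_sub_distrib, ← Finset.sum_mul,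
      ← Finset.mul_sum, ← hP, p22]
    noncomm_ring
  have hfin := aux_rect (Matrix.of fun (l : Fin (k + 3)) (j : Fin 2) =>
    if j = 0 then Q l 0 - Q l 2 * Φ A else Q l 1 - Q l 2 * Φ B)
  convert hfin using 1
  have k00 := key 0 0
  have k01 := key 0 1
  have k10 := key 1 0
  have k11 := key 1 1
  rw [p00, p02, p20] at k00
  rw [p01, p02, p21] at k01
  rw [p10, p12, p20] at k10
  rw [p11, p12, p21] at k11
  ext i j
  rw [Matrix.mul_apply]
  fin_cases i <;> fin_cases j
  · simpa using k00.symm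
  · simpa using k01.symm
  · simpa using k10.symm
  · simpa using k11.symm
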